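/- Let G and H be finite connected simple graphs such that the eccentric graph E(G) contains a cycle and the eccentric graph E(H) contains a cycle. If it is not the case that both E(G) and E(H) have girth 3, then the girth of E(G □ H) equals 4. -/

import Mathlib

open SimpleGraph

/-- The eccentricity of a vertex `v`: the max distance from `v` to any vertex. -/
noncomputable def ecc {V : Type*} [Fintype V] (G : SimpleGraph V) (v : V) : ℕ :=
  Finset.univ.sup fun u => G.dist v u

/-- `u` is eccentric to `v` in `G` if `d(v,u) = e(v)`. -/
def IsEccentric {V : Type*} [Fintype V] (G : SimpleGraph V) (v u : V) : Prop :=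
  G.dist v u = ecc G v

/-- The eccentric graph of `G`: distinct `u, v` adjacent iff one is eccentric to the other. -/
noncomputable def eccGraph {V : Type*} [Fintype V] (G : SimpleGraph V) : SimpleGraph V :=
  SimpleGraph.fromRel fun u v => IsEccentric G u v

/-- The diameter of `G`: the maximum eccentricity. -/
noncomputable def gdiam {V : Type*} [Fintype V] (G : SimpleGraph V) : ℕ :=
  Finset.univ.sup fun v => ecc G v

lemma SimpleGraph.dist_boxProd {α β : Type*} {G : SimpleGraph α} {H : SimpleGraph β}
    (hG : G.Connected) (hH : H.Connected) (x y : α × β) :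
    (G.boxProd H).dist x y = G.dist x.1 y.1 + H.dist x.2 y.2 := by
  simp only [SimpleGraph.dist, SimpleGraph.edist_boxProd]
  exact ENat.toNat_add (SimpleGraph.edist_ne_top_iff_reachable.mpr (hG _ _))
    (SimpleGraph.edist_ne_top_iff_reachable.mpr (hH _ _))

section EccentricGraph

variable {α β : Type*} [Fintype α] [Fintype β] {G : SimpleGraph α} {H : SimpleGraph β}

lemma dist_le_ecc (G : SimpleGraph α) (u v : α) : G.dist u v ≤ ecc G u :=
  Finset.le_sup (f := fun w => G.dist u w) (Finset.mem_univ v)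

lemma exists_isEccentric (G : SimpleGraph α) (v : α) : ∃ u, IsEccentric G v u := by
  obtain ⟨u, -, hu⟩ := Finset.exists_mem_eq_sup Finset.univ ⟨v, Finset.mem_univ v⟩
    (fun w => G.dist v w)
  exact ⟨u, hu.symm⟩

lemma eccGraph_adj {u v : α} :
    (eccGraph G).Adj u v ↔ u ≠ v ∧ (IsEccentric G u v ∨ IsEccentric G v u) :=
  SimpleGraph.fromRel_adj _ _ _

lemma IsEccentric.ne [Nontrivial α] (hG : G.Connected) {u v : α} (h : IsEccentric G u v) :
    u ≠ v := by
  rintro rfl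
  obtain ⟨w, hw⟩ := exists_ne u
  have h1 := dist_le_ecc G u w
  rw [← h, SimpleGraph.dist_self] at h1
  have h2 := hG.pos_dist_of_ne hw.symm
  omega

/-- A neighbour of `v` in the eccentric graph whose eccentricity is not below that of `v` is
eccentric to `v`. -/
lemma IsEccentric.of_eccGraph_adj {u v : α} (h : (eccGraph G).Adj v u)
    (hle : ecc G v ≤ ecc G u) : IsEccentric G v u := by
  rcases (eccGraph_adj.mp h).2 with h | h
  · exact h
  · refine le_antisymm (dist_le_ecc G v u) ?_
    rw [SimpleGraph.dist_comm, h]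
    exact hle

/-- A vertex of minimal eccentricity on a cycle of the eccentric graph has both of its neighbours
on the cycle as eccentric vertices. -/
lemma exists_isEccentric_ne_of_not_isAcyclic (h : ¬ (eccGraph G).IsAcyclic) :
    ∃ v a b, a ≠ b ∧ IsEccentric G v a ∧ IsEccentric G v b := by
  classical
  obtain ⟨x, w, hw, -⟩ := SimpleGraph.exists_egirth_eq_length.mpr h
  obtain ⟨v, hv, hmin⟩ := Finset.exists_min_image w.support.toFinset (ecc G)
    ⟨x, by simp⟩
  simp only [List.mem_toFinset] at hv hmin
  have hc : (w.rotate v hv).IsCycle := hw.rotate hv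
  have hmem : ∀ u ∈ (w.rotate v hv).support, ecc G v ≤ ecc G u := fun u hu =>
    hmin u (by simpa using hu)
  refine ⟨v, _, _, hc.snd_ne_penultimate, ?_, ?_⟩
  · exact .of_eccGraph_adj (SimpleGraph.Walk.adj_snd hc.not_nil)
      (hmem _ (SimpleGraph.Walk.getVert_mem_support _ _))
  · exact .of_eccGraph_adj (SimpleGraph.Walk.adj_penultimate hc.not_nil).symm
      (hmem _ (SimpleGraph.Walk.getVert_mem_support _ _))

lemma exists_ne_isEccentric_of_not_isAcyclic (h : ¬ (eccGraph G).IsAcyclic) :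
    ∃ x y v, x ≠ y ∧ IsEccentric G x v ∧ IsEccentric G y v := by
  obtain ⟨v, a, b, hab, ha, hb⟩ := exists_isEccentric_ne_of_not_isAcyclic h
  by_contra! hinj
  choose f hf using exists_isEccentric G
  have hf_inj : Function.Injective f := fun x y hxy => by
    by_contra hne
    exact hinj x y (f y) hne (hxy ▸ hf x) (hf y)
  have key : ∀ c, IsEccentric G v c → f v = c := fun c hc => by
    obtain ⟨u, rfl⟩ := Finite.surjective_of_injective hf_inj c
    by_contra hne
    exact hinj v u (f u) (fun e => hne (by rw [e])) hc (hf u)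
  exact hab ((key a ha).symm.trans (key b hb))

lemma ecc_boxProd (hG : G.Connected) (hH : H.Connected) (x : α × β) :
    ecc (G.boxProd H) x = ecc G x.1 + ecc H x.2 := by
  apply le_antisymm
  · refine Finset.sup_le fun y _ => ?_
    rw [dist_boxProd hG hH]
    exact add_le_add (dist_le_ecc _ _ _) (dist_le_ecc _ _ _)
  · obtain ⟨a, ha⟩ := exists_isEccentric G x.1
    obtain ⟨b, hb⟩ := exists_isEccentric H x.2
    rw [← ha, ← hb, ← dist_boxProd hG hH x (a, b)]
    exact dist_le_ecc _ _ _

lemma isEccentric_boxProd (hG : G.Connected) (hH : H.Connected) {x y : α × β} :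
    IsEccentric (G.boxProd H) x y ↔ IsEccentric G x.1 y.1 ∧ IsEccentric H x.2 y.2 := by
  have h1 := dist_le_ecc G x.1 y.1
  have h2 := dist_le_ecc H x.2 y.2
  simp only [IsEccentric, ecc_boxProd hG hH, dist_boxProd hG hH]
  omega

lemma adj_of_eccGraph_boxProd_adj [Nontrivial α] [Nontrivial β] (hG : G.Connected) (hH : H.Connected)
    {x y : α × β} (h : (eccGraph (G.boxProd H)).Adj x y) :
    (eccGraph G).Adj x.1 y.1 ∧ (eccGraph H).Adj x.2 y.2 := by
  simp only [eccGraph_adj, isEccentric_boxProd hG hH] at h ⊢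
  rcases h.2 with ⟨h1, h2⟩ | ⟨h1, h2⟩
  · exact ⟨⟨h1.ne hG, .inl h1⟩, h2.ne hH, .inl h2⟩
  · exact ⟨⟨(h1.ne hG).symm, .inr h1⟩, (h2.ne hH).symm, .inr h2⟩

end EccentricGraph

lemma SimpleGraph.egirth_eq_three_of_adj {V : Type*} {G : SimpleGraph V} {a b c : V}
    (hab : G.Adj a b) (hac : G.Adj a c) (hbc : G.Adj b c) : G.egirth = 3 := by
  classical
  obtain ⟨u, w, hw, hl⟩ := is3Clique_iff_exists_cycle_length_three.mp
    ⟨{a, b, c}, SimpleGraph.is3Clique_triple_iff.mpr ⟨hab, hac, hbc⟩⟩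
  refine le_antisymm ?_ SimpleGraph.three_le_egirth
  simpa [hl] using SimpleGraph.egirth_le_length hw

lemma SimpleGraph.egirth_le_four_of_adj {V : Type*} {G : SimpleGraph V} {a b c d : V}
    (hab : G.Adj a b) (hbc : G.Adj b c) (hcd : G.Adj c d) (hda : G.Adj d a)
    (hac : a ≠ c) (hbd : b ≠ d) : G.egirth ≤ 4 := by
  have hw : (Walk.cons hab (.cons hbc (.cons hcd (.cons hda .nil)))).IsCycle := by
    have := hab.ne
    have := hbc.ne
    have := hcd.ne
    have := hda.ne
    rw [Walk.cons_isCycle_iff]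
    simp [Walk.isPath_def]
    grind
  simpa using egirth_le_length hw

/-- If the eccentric graphs of both factors contain cycles but do not both have girth 3, then
the eccentric graph of the box product has girth 4. -/
theorem stmt_8 {α β : Type*} [Fintype α] [Fintype β]
    (G : SimpleGraph α) (H : SimpleGraph β) (hG : G.Connected) (hH : H.Connected)
    (hGcyc : ¬ (eccGraph G).IsAcyclic) (hHcyc : ¬ (eccGraph H).IsAcyclic)
    (hnot3 : ¬ ((eccGraph G).egirth = 3 ∧ (eccGraph H).egirth = 3)) :
    (eccGraph (G.boxProd H)).egirth = 4 := by
  classical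
  obtain ⟨v, a, b, hab, ha, hb⟩ := exists_isEccentric_ne_of_not_isAcyclic hGcyc
  obtain ⟨x, y, z, hxy, hx, hy⟩ := exists_ne_isEccentric_of_not_isAcyclic hHcyc
  have : Nontrivial α := ⟨a, b, hab⟩
  have : Nontrivial β := ⟨x, y, hxy⟩
  apply le_antisymm
  · have key : ∀ {c : α} {t : β}, IsEccentric G v c → IsEccentric H t z →
        (eccGraph (G.boxProd H)).Adj (v, t) (c, z) := fun hc ht =>
      eccGraph_adj.mpr ⟨fun e => hc.ne hG (congrArg Prod.fst e),
        .inl ((isEccentric_boxProd hG hH).mpr ⟨hc, ht⟩)⟩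
    exact SimpleGraph.egirth_le_four_of_adj (key ha hx) (key ha hy).symm (key hb hy)
      (key hb hx).symm (by simpa using hxy) (by simpa using hab)
  · refine SimpleGraph.le_egirth.mpr fun p w hw => ?_
    have hlen : w.length ≠ 3 := fun hl => by
      obtain ⟨s, hs⟩ := SimpleGraph.is3Clique_iff_exists_cycle_length_three.mpr ⟨p, w, hw, hl⟩
      obtain ⟨q, r, t, hqr, hqt, hrt, -⟩ := SimpleGraph.is3Clique_iff.mp hs
      have h1 := adj_of_eccGraph_boxProd_adj hG hH hqr
      have h2 := adj_of_eccGraph_boxProd_adj hG hH hqt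
      have h3 := adj_of_eccGraph_boxProd_adj hG hH hrt
      exact hnot3 ⟨SimpleGraph.egirth_eq_three_of_adj h1.1 h2.1 h3.1,
        SimpleGraph.egirth_eq_three_of_adj h1.2 h2.2 h3.2⟩
    have hge := hw.three_le_length
    have : 4 ≤ w.length := by omega
    exact_mod_cast this
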